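/- Let n ∈ ℕ with n ≥ 1, β ∈ (0,1], and Φ₀ = Id + φ₀ ∈ D^{n,β}(ℝ^d). Then: (1) ε := inf_{x∈ℝ^d} det dΦ₀(x) > 0; (2) there exists δ > 0 such that inf_{x∈ℝ^d} det dΦ(x) ≥ ε/2 for every Φ = Id + φ with ‖φ − φ₀‖_{n,β} < δ and φ ∈ C^{n,β}_0(ℝ^d,ℝ^d); (3) there exist δ > 0 and C > 0 such that sup_{x∈ℝ^d} ‖dΦ⁻¹(x)‖ ≤ C for every Φ ∈ D^{n,β}(ℝ^d) with ‖Φ − Φ₀‖_{n,β} < δ. -/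

import Mathlib

open Function Set Filter Topology MeasureTheory
open scoped ENNReal NNReal

noncomputable section

section Defs

variable {E F : Type*} [NormedAddCommGroup E] [NormedSpace ℝ E]
  [NormedAddCommGroup F] [NormedSpace ℝ F]

/-- `‖f‖_n = max_{0 ≤ l ≤ n} sup_x ‖f⁽ˡ⁾(x)‖`, as an extended real. -/
def eCnb (n : ℕ) (f : E → F) : ℝ≥0∞ :=
  ⨆ (l : Fin (n + 1)) (x : E), (‖iteratedFDeriv ℝ (l : ℕ) f x‖₊ : ℝ≥0∞)

/-- The Hölder seminorm `[f]_{n,α}`, as an extended real. -/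
def eHsemi (n : ℕ) (α : ℝ) (f : E → F) : ℝ≥0∞ :=
  ⨆ (x : E) (y : E) (_ : x ≠ y),
    (‖iteratedFDeriv ℝ n f x - iteratedFDeriv ℝ n f y‖₊ : ℝ≥0∞) / edist x y ^ α

/-- The Hölder norm `‖f‖_{n,α} = max(‖f‖_n, [f]_{n,α})`, as an extended real. -/
def eHnorm (n : ℕ) (α : ℝ) (f : E → F) : ℝ≥0∞ := max (eCnb n f) (eHsemi n α f)

/-- The Hölder norm `‖f‖_{n,α}` as a real number (junk value `0` when infinite). -/
def hnorm (n : ℕ) (α : ℝ) (f : E → F) : ℝ := (eHnorm n α f).toReal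

/-- Membership in the global Hölder space `C^{n,α}_b(E,F)`. -/
def MemCb (n : ℕ) (α : ℝ) (f : E → F) : Prop :=
  ContDiff ℝ (n : ℕ∞) f ∧ eHnorm n α f < ⊤

/-- Membership in `C^{n,α}_0(E,F)`: moreover all derivatives up to order `n`
vanish at infinity. -/
def MemC0 (n : ℕ) (α : ℝ) (f : E → F) : Prop :=
  MemCb n α f ∧
    ∀ l ≤ n, Tendsto (fun x => ‖iteratedFDeriv ℝ l f x‖) (cocompact E) (𝓝 0)

end Defs

/-- `ℝ^d` -/
abbrev Euc (d : ℕ) : Type := EuclideanSpace ℝ (Fin d)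

/-- Membership in the diffeomorphism group `D^{n,β}(ℝ^d)`:
`Φ - Id ∈ C^{n,β}_0` and `det dΦ(x) > 0` everywhere. -/
def MemD (d n : ℕ) (β : ℝ) (Φ : Euc d → Euc d) : Prop :=
  MemC0 n β (fun x => Φ x - x) ∧
    ∀ x, 0 < LinearMap.det ((fderiv ℝ Φ x : Euc d →L[ℝ] Euc d) : Euc d →ₗ[ℝ] Euc d)

end

section HolderNorm

variable {E F : Type*} [NormedAddCommGroup E] [NormedSpace ℝ E]
  [NormedAddCommGroup F] [NormedSpace ℝ F]

theorem enorm_iteratedFDeriv_le_eCnb {n l : ℕ} (hl : l ≤ n) (f : E → F) (x : E) :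
    (‖iteratedFDeriv ℝ l f x‖₊ : ℝ≥0∞) ≤ eCnb n f :=
  le_iSup₂_of_le (f := fun (l : Fin (n + 1)) (x : E) =>
    (‖iteratedFDeriv ℝ (l : ℕ) f x‖₊ : ℝ≥0∞)) ⟨l, Nat.lt_succ_of_le hl⟩ x le_rfl

theorem norm_iteratedFDeriv_le_hnorm {n l : ℕ} (hl : l ≤ n) {α : ℝ} {f : E → F}
    (hf : eHnorm n α f < ⊤) (x : E) : ‖iteratedFDeriv ℝ l f x‖ ≤ hnorm n α f := by
  have h := (enorm_iteratedFDeriv_le_eCnb hl f x).trans (le_max_left _ (eHsemi n α f))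
  simpa [hnorm, eHnorm] using ENNReal.toReal_mono hf.ne h

theorem norm_le_hnorm {n : ℕ} {α : ℝ} {f : E → F} (hf : eHnorm n α f < ⊤) (x : E) :
    ‖f x‖ ≤ hnorm n α f := by
  simpa using norm_iteratedFDeriv_le_hnorm (Nat.zero_le n) hf x

theorem norm_fderiv_le_hnorm {n : ℕ} (hn : 1 ≤ n) {α : ℝ} {f : E → F}
    (hf : eHnorm n α f < ⊤) (x : E) : ‖fderiv ℝ f x‖ ≤ hnorm n α f := by
  simpa [norm_iteratedFDeriv_one] using norm_iteratedFDeriv_le_hnorm hn hf x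

theorem eCnb_sub_le {n : ℕ} {f g : E → F} (hf : ContDiff ℝ (n : ℕ∞) f)
    (hg : ContDiff ℝ (n : ℕ∞) g) : eCnb n (f - g) ≤ eCnb n f + eCnb n g := by
  refine iSup₂_le fun l x => ?_
  have hl : ((l : ℕ) : ℕ∞) ≤ n := by exact_mod_cast Nat.le_of_lt_succ l.2
  have hl' : (((l : ℕ) : ℕ∞) : WithTop ℕ∞) ≤ ((n : ℕ∞) : WithTop ℕ∞) := by exact_mod_cast hl
  have hs : iteratedFDeriv ℝ (l : ℕ) (f - g) x =
      iteratedFDeriv ℝ (l : ℕ) f x - iteratedFDeriv ℝ (l : ℕ) g x :=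
    iteratedFDeriv_sub_apply (hf.of_le hl').contDiffAt (hg.of_le hl').contDiffAt
  rw [hs]
  calc (‖iteratedFDeriv ℝ (l : ℕ) f x - iteratedFDeriv ℝ (l : ℕ) g x‖₊ : ℝ≥0∞)
      ≤ ‖iteratedFDeriv ℝ (l : ℕ) f x‖₊ + ‖iteratedFDeriv ℝ (l : ℕ) g x‖₊ := by
        exact_mod_cast nnnorm_sub_le _ _
    _ ≤ _ := add_le_add (enorm_iteratedFDeriv_le_eCnb (Nat.le_of_lt_succ l.2) f x)
        (enorm_iteratedFDeriv_le_eCnb (Nat.le_of_lt_succ l.2) g x)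

theorem eHsemi_sub_le {n : ℕ} {α : ℝ} {f g : E → F} (hf : ContDiff ℝ (n : ℕ∞) f)
    (hg : ContDiff ℝ (n : ℕ∞) g) : eHsemi n α (f - g) ≤ eHsemi n α f + eHsemi n α g := by
  refine iSup_le fun x => iSup₂_le fun y hxy => ?_
  have hs : iteratedFDeriv ℝ n (f - g) = iteratedFDeriv ℝ n f - iteratedFDeriv ℝ n g :=
    iteratedFDeriv_sub hf hg
  have hle (h : E → F) : (‖iteratedFDeriv ℝ n h x - iteratedFDeriv ℝ n h y‖₊ : ℝ≥0∞) /
      edist x y ^ α ≤ eHsemi n α h :=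
    le_iSup_of_le x (le_iSup₂_of_le y hxy le_rfl)
  refine le_trans ?_ (add_le_add (hle f) (hle g))
  rw [← ENNReal.add_div, hs]
  refine ENNReal.div_le_div_right ?_ _
  rw [Pi.sub_apply, Pi.sub_apply, sub_sub_sub_comm]
  exact_mod_cast nnnorm_sub_le _ _

theorem MemCb.sub {n : ℕ} {α : ℝ} {f g : E → F} (hf : MemCb n α f) (hg : MemCb n α g) :
    MemCb n α (f - g) := by
  have h₁ := max_lt_iff.1 hf.2
  have h₂ := max_lt_iff.1 hg.2
  exact ⟨hf.1.sub hg.1, max_lt_iff.2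
    ⟨(eCnb_sub_le hf.1 hg.1).trans_lt (ENNReal.add_lt_top.2 ⟨h₁.1, h₂.1⟩),
      (eHsemi_sub_le hf.1 hg.1).trans_lt (ENNReal.add_lt_top.2 ⟨h₁.2, h₂.2⟩)⟩⟩

theorem MemCb.contDiff_one {n : ℕ} (hn : 1 ≤ n) {α : ℝ} {f : E → F} (hf : MemCb n α f) :
    ContDiff ℝ 1 f :=
  hf.1.of_le (by exact_mod_cast hn)

end HolderNorm

section Determinant

variable {E : Type*} [NormedAddCommGroup E] [NormedSpace ℝ E]

theorem ContinuousLinearMap.isUnit_of_det_ne_zero [FiniteDimensional ℝ E] {A : E →L[ℝ] E}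
    (h : A.det ≠ 0) : IsUnit A := by
  rw [← A.coe_toContinuousLinearEquivOfDetNeZero h]
  exact ⟨(ContinuousLinearEquiv.unitsEquiv ℝ E).symm
    (A.toContinuousLinearEquivOfDetNeZero h), rfl⟩

theorem exists_det_sub_lt [FiniteDimensional ℝ E] (M : ℝ) {c : ℝ} (hc : 0 < c) :
    ∃ δ > 0, ∀ A B : E →L[ℝ] E, ‖A‖ ≤ M → ‖B - A‖ < δ → |B.det - A.det| < c := by
  have : ProperSpace (E →L[ℝ] E) := FiniteDimensional.proper ℝ _
  have hu := (isCompact_closedBall (0 : E →L[ℝ] E) (M + 1)).uniformContinuousOn_of_continuous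
    ContinuousLinearMap.continuous_det.continuousOn
  obtain ⟨δ, hδ, h⟩ := Metric.uniformContinuousOn_iff.1 hu c hc
  refine ⟨min δ 1, lt_min hδ one_pos, fun A B hA hAB => ?_⟩
  have hB : ‖B‖ ≤ M + 1 := by
    have := norm_le_norm_add_norm_sub' B A
    linarith [hAB.trans_le (min_le_right δ 1)]
  have := h B (by simpa using hB) A (by simpa using hA.trans (by linarith))
    (by simpa [dist_eq_norm] using hAB.trans_le (min_le_left δ 1))
  simpa [Real.dist_eq] using this

theorem exists_norm_right_inverse_le [FiniteDimensional ℝ E] (M : ℝ) {c : ℝ} (hc : 0 < c) :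
    ∃ C > 0, ∀ A B : E →L[ℝ] E, ‖A‖ ≤ M → c ≤ A.det → A * B = 1 → ‖B‖ ≤ C := by
  have : ProperSpace (E →L[ℝ] E) := FiniteDimensional.proper ℝ _
  have : CompleteSpace E := FiniteDimensional.complete ℝ E
  let S : Set (E →L[ℝ] E) := Metric.closedBall 0 M ∩ {A | c ≤ A.det}
  have hS : IsCompact S := (isCompact_closedBall _ _).inter_right
    (isClosed_le continuous_const ContinuousLinearMap.continuous_det)
  have hunit (A : E →L[ℝ] E) (hA : c ≤ A.det) : IsUnit A :=
    A.isUnit_of_det_ne_zero (hc.trans_le hA).ne'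
  have hcont : ContinuousOn Ring.inverse S := fun A hA => by
    obtain ⟨u, rfl⟩ := hunit A hA.2
    exact (NormedRing.inverse_continuousAt u).continuousWithinAt
  obtain ⟨C, hC⟩ := (hS.image_of_continuousOn hcont).isBounded.exists_norm_le
  refine ⟨max C 1, lt_max_of_lt_right one_pos, fun A B hA hdet hAB => ?_⟩
  have hB : Ring.inverse A = B := by
    rw [← mul_one (Ring.inverse A), ← hAB, ← mul_assoc,
      Ring.inverse_mul_cancel A (hunit A hdet), one_mul]
  rw [← hB]
  exact (hC _ ⟨A, ⟨by simpa using hA, hdet⟩, rfl⟩).trans (le_max_left _ _)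

theorem iInf_pos_of_tendsto_cocompact {X : Type*} [TopologicalSpace X] [Nonempty X] {f : X → ℝ}
    (hf : Continuous f) (hpos : ∀ x, 0 < f x) {a : ℝ} (ha : 0 < a)
    (hlim : Tendsto f (cocompact X) (𝓝 a)) : 0 < ⨅ x, f x := by
  obtain ⟨K, hK, hKf⟩ := mem_cocompact.1 (hlim.eventually_const_lt (half_lt_self ha))
  have hout (x : X) (hx : x ∉ K) : a / 2 < f x := hKf hx
  rcases K.eq_empty_or_nonempty with rfl | hne
  · exact (half_pos ha).trans_le (le_ciInf fun x => (hout x (by simp)).le)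
  · obtain ⟨x₀, -, hmin⟩ := hK.exists_isMinOn hne hf.continuousOn
    refine (lt_min (hpos x₀) (half_pos ha)).trans_le (le_ciInf fun x => ?_)
    by_cases hx : x ∈ K
    · exact (min_le_left _ _).trans (hmin hx)
    · exact (min_le_right _ _).trans (hout x hx).le

theorem surjective_of_det_fderiv_ne_zero [FiniteDimensional ℝ E] {Φ : E → E}
    (hΦ : ContDiff ℝ 1 Φ) (hdet : ∀ x, (fderiv ℝ Φ x).det ≠ 0) {M : ℝ}
    (hM : ∀ x, ‖Φ x - x‖ ≤ M) : Function.Surjective Φ := by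
  have : ProperSpace E := FiniteDimensional.proper ℝ E
  have : CompleteSpace E := FiniteDimensional.complete ℝ E
  have hopen : IsOpenMap Φ := isOpenMap_iff_nhds_le.2 fun x => by
    have hs : HasStrictFDerivAt Φ (((fderiv ℝ Φ x).toContinuousLinearEquivOfDetNeZero (hdet x) :
        E ≃L[ℝ] E) : E →L[ℝ] E) x := by
      rw [ContinuousLinearMap.coe_toContinuousLinearEquivOfDetNeZero]
      exact hΦ.hasStrictFDerivAt one_ne_zero
    exact hs.map_nhds_eq_of_equiv.ge
  have hlim : Tendsto Φ (cocompact E) (cocompact E) := by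
    refine tendsto_cocompact_of_tendsto_dist_comp_atTop 0 ?_
    refine tendsto_atTop_mono (fun x => ?_)
      (tendsto_atTop_add_const_right _ (-M) (tendsto_norm_cocompact_atTop (E := E)))
    rw [dist_zero_right]
    have := norm_le_norm_add_norm_sub (Φ x) x
    linarith [hM x]
  have hproper : IsProperMap Φ := isProperMap_iff_tendsto_cocompact.2 ⟨hΦ.continuous, hlim⟩
  rw [← Set.range_eq_univ]
  exact IsClopen.eq_univ ⟨hproper.isClosedMap.isClosed_range, hopen.isOpen_range⟩
    (Set.range_nonempty Φ)

theorem exists_norm_fderiv_invFun_le [FiniteDimensional ℝ E] (M : ℝ) {c : ℝ} (hc : 0 < c) :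
    ∃ C > 0, ∀ Φ : E → E, Differentiable ℝ Φ → Function.Surjective Φ →
      (∀ x, ‖fderiv ℝ Φ x‖ ≤ M) → (∀ x, c ≤ (fderiv ℝ Φ x).det) →
      ∀ x, ‖fderiv ℝ (Function.invFun Φ) x‖ ≤ C := by
  obtain ⟨C, hC, h⟩ := exists_norm_right_inverse_le (E := E) M hc
  refine ⟨C, hC, fun Φ hΦ hsurj hM hdet x => ?_⟩
  by_cases hg : DifferentiableAt ℝ (Function.invFun Φ) x
  · refine h _ _ (hM (Function.invFun Φ x)) (hdet _) ?_
    have hcomp := fderiv_comp x (hΦ (Function.invFun Φ x)) hg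
    rw [(Function.rightInverse_invFun hsurj).comp_eq_id, fderiv_id] at hcomp
    exact hcomp.symm
  · rw [fderiv_zero_of_not_differentiableAt hg, norm_zero]
    exact hC.le

end Determinant

section NearIdentity

variable {d n : ℕ} {β : ℝ} {Φ Φ₀ : Euc d → Euc d}

theorem MemC0.contDiff_of_sub_id (hn : 1 ≤ n) (h : MemC0 n β fun x => Φ x - x) :
    ContDiff ℝ 1 Φ := by
  simpa using (h.1.contDiff_one hn).add contDiff_id

theorem MemC0.fderiv_sub_id (hn : 1 ≤ n) (h : MemC0 n β fun x => Φ x - x) (x : Euc d) :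
    fderiv ℝ (fun x => Φ x - x) x = fderiv ℝ Φ x - 1 := by
  rw [fderiv_fun_sub ((h.contDiff_of_sub_id hn).differentiable one_ne_zero x)
    differentiableAt_fun_id, fderiv_fun_id]
  rfl

theorem MemC0.norm_fderiv_le (hn : 1 ≤ n) (h : MemC0 n β fun x => Φ x - x) (x : Euc d) :
    ‖fderiv ℝ Φ x‖ ≤ hnorm n β (fun x => Φ x - x) + 1 := by
  have h₁ := norm_fderiv_le_hnorm hn h.1.2 x
  rw [h.fderiv_sub_id hn] at h₁
  have h₂ := norm_le_norm_add_norm_sub' (fderiv ℝ Φ x) 1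
  have h₃ : ‖(1 : Euc d →L[ℝ] Euc d)‖ ≤ 1 := ContinuousLinearMap.norm_id_le
  linarith

theorem MemC0.tendsto_fderiv (hn : 1 ≤ n) (h : MemC0 n β fun x => Φ x - x) :
    Tendsto (fderiv ℝ Φ) (cocompact (Euc d)) (𝓝 1) := by
  refine tendsto_iff_norm_sub_tendsto_zero.2 ((h.2 1 hn).congr fun x => ?_)
  rw [norm_iteratedFDeriv_one, h.fderiv_sub_id hn]

theorem MemC0.norm_fderiv_sub_le (hn : 1 ≤ n) (h : MemC0 n β fun x => Φ x - x)
    (h₀ : MemC0 n β fun x => Φ₀ x - x) (x : Euc d) :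
    ‖fderiv ℝ Φ x - fderiv ℝ Φ₀ x‖ ≤ hnorm n β fun x => Φ x - Φ₀ x := by
  have heq : ((fun x => Φ x - x) - fun x => Φ₀ x - x) = fun x => Φ x - Φ₀ x := by
    ext1 x
    simp
  have hfin := (h.1.sub h₀.1).2
  rw [heq] at hfin
  rw [← fderiv_fun_sub ((h.contDiff_of_sub_id hn).differentiable one_ne_zero x)
    ((h₀.contDiff_of_sub_id hn).differentiable one_ne_zero x)]
  exact norm_fderiv_le_hnorm hn hfin x

theorem MemD.iInf_det_pos (hn : 1 ≤ n) (h : MemD d n β Φ) : 0 < ⨅ x, (fderiv ℝ Φ x).det := by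
  refine iInf_pos_of_tendsto_cocompact (ContinuousLinearMap.continuous_det.comp
    ((h.1.contDiff_of_sub_id hn).continuous_fderiv one_ne_zero)) h.2 one_pos ?_
  have hlim := (ContinuousLinearMap.continuous_det.tendsto (1 : Euc d →L[ℝ] Euc d)).comp
    (h.1.tendsto_fderiv hn)
  rwa [show (1 : Euc d →L[ℝ] Euc d).det = 1 from LinearMap.det_id] at hlim

theorem MemD.exists_half_iInf_det_le (hn : 1 ≤ n) (h₀ : MemD d n β Φ₀) :
    ∃ δ > 0, ∀ Φ : Euc d → Euc d, MemC0 n β (fun x => Φ x - x) →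
      hnorm n β (fun x => Φ x - Φ₀ x) < δ →
      ∀ x, (⨅ y, (fderiv ℝ Φ₀ y).det) / 2 ≤ (fderiv ℝ Φ x).det := by
  obtain ⟨δ, hδ, hdet⟩ := exists_det_sub_lt (E := Euc d)
    (hnorm n β (fun x => Φ₀ x - x) + 1) (half_pos (h₀.iInf_det_pos hn))
  refine ⟨δ, hδ, fun Φ hΦ hlt x => ?_⟩
  have h := hdet _ _ (h₀.1.norm_fderiv_le hn x) ((hΦ.norm_fderiv_sub_le hn h₀.1 x).trans_lt hlt)
  have hbdd : BddBelow (range fun y => (fderiv ℝ Φ₀ y).det) :=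
    ⟨0, forall_mem_range.2 fun y => (h₀.2 y).le⟩
  linarith [(abs_lt.1 h).1, ciInf_le hbdd x]

theorem MemD.exists_norm_fderiv_invFun_le (hn : 1 ≤ n) (h₀ : MemD d n β Φ₀) :
    ∃ δ > (0 : ℝ), ∃ C > (0 : ℝ), ∀ Φ : Euc d → Euc d, MemD d n β Φ →
      hnorm n β (fun x => Φ x - Φ₀ x) < δ →
      ∀ x, ‖fderiv ℝ (Function.invFun Φ) x‖ ≤ C := by
  obtain ⟨δ, hδ, hdet⟩ := h₀.exists_half_iInf_det_le hn
  obtain ⟨C, hC, hinv⟩ := _root_.exists_norm_fderiv_invFun_le (E := Euc d)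
    (hnorm n β (fun x => Φ₀ x - x) + 1 + δ) (half_pos (h₀.iInf_det_pos hn))
  refine ⟨δ, hδ, C, hC, fun Φ hΦ hlt => ?_⟩
  have hsmooth := hΦ.1.contDiff_of_sub_id hn
  refine hinv Φ (hsmooth.differentiable one_ne_zero)
    (surjective_of_det_fderiv_ne_zero hsmooth (fun x => (hΦ.2 x).ne') (norm_le_hnorm hΦ.1.1.2))
    (fun x => ?_) (hdet Φ hΦ.1 hlt)
  have := norm_le_norm_add_norm_sub' (fderiv ℝ Φ x) (fderiv ℝ Φ₀ x)
  linarith [h₀.1.norm_fderiv_le hn x, hΦ.1.norm_fderiv_sub_le hn h₀.1 x]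

end NearIdentity

/-- uniform bounds near a fixed `Φ₀ ∈ D^{n,β}(ℝ^d)`:
(1) `ε := inf_x det dΦ₀(x) > 0`;
(2) there is `δ > 0` such that `det dΦ(x) ≥ ε/2` for all `x` whenever
    `Φ = Id + φ` with `φ ∈ C^{n,β}_0` and `‖φ − φ₀‖_{n,β} < δ`;
(3) there are `δ, C > 0` with `sup_x ‖dΦ⁻¹(x)‖ ≤ C` for all
    `Φ ∈ D^{n,β}(ℝ^d)` with `‖Φ − Φ₀‖_{n,β} < δ`. -/
theorem stmt8 (d n : ℕ) (hn : 1 ≤ n) (β : ℝ) (hβ0 : 0 < β) (hβ1 : β ≤ 1)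
    (Φ₀ : Euc d → Euc d) (hΦ₀ : MemD d n β Φ₀) :
    (0 < ⨅ x, LinearMap.det ((fderiv ℝ Φ₀ x : Euc d →L[ℝ] Euc d) : Euc d →ₗ[ℝ] Euc d)) ∧
    (∃ δ > (0 : ℝ), ∀ Φ : Euc d → Euc d, MemC0 n β (fun x => Φ x - x) →
      hnorm n β (fun x => Φ x - Φ₀ x) < δ →
      ∀ x, (⨅ y, LinearMap.det ((fderiv ℝ Φ₀ y : Euc d →L[ℝ] Euc d) : Euc d →ₗ[ℝ] Euc d)) / 2 ≤
        LinearMap.det ((fderiv ℝ Φ x : Euc d →L[ℝ] Euc d) : Euc d →ₗ[ℝ] Euc d)) ∧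
    (∃ δ > (0 : ℝ), ∃ C > (0 : ℝ), ∀ Φ : Euc d → Euc d, MemD d n β Φ →
      hnorm n β (fun x => Φ x - Φ₀ x) < δ →
      ∀ x, ‖fderiv ℝ (Function.invFun Φ) x‖ ≤ C) := by
  exact ⟨hΦ₀.iInf_det_pos hn, hΦ₀.exists_half_iInf_det_le hn,
    hΦ₀.exists_norm_fderiv_invFun_le hn⟩
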